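/- arXiv:1904.04343 — 2 statements merged into one kernel-verified Lean document; each statement's English description precedes it below -/
import Mathlib

section
/- Let b ∈ C with b ≠ -1, and let φ be a conformal biderivation of the loop W(a,b) Lie conformal algebra CLW(a,b). Then there exists a family of complex numbers (a_k)_{k∈Z} such that φ_λ(L_i,L_j) = (∂+2λ)Σ_{k∈Z} a_{k-i-j} L_k, φ_λ(G_i,G_j) = 0, and φ_λ(L_i,G_j) = (∂+(1-b)λ)Σ_{k∈Z} a_{k-i-j} G_k, for all i, j ∈ Z. -/
/- Framework: a Lie conformal algebra over ℂ is a ℂ[∂]-module `R` (given by a ℂ-module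
with a ℂ-linear operator `D` for the action of `∂`) with a λ-bracket `B : R → R → R[λ]`.
We model `R[λ]` as `ℕ →₀ R` (coefficient of `λ^n` at index `n`) and `R[λ,μ,γ]` as an
iterated Finsupp.  Substitutions of the bracket variable are implemented by evaluating
the polynomial at a commuting operator (e.g. multiplication by `λ`, by `λ+μ`, or by
`-∂-λ`), and brackets/biderivations are extended to polynomial-valued arguments by
ℂ[λ,μ,γ]-bilinearity. -/

namespace ConfBider

variable {R : Type} [AddCommGroup R] [Module ℂ R]

/-- `R[λ]`. -/
abbrev Pol1 (R : Type) [AddCommGroup R] : Type := ℕ →₀ R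

/-- `R[λ,μ,γ]`: index `a` is the exponent of `λ`, then `μ`, then `γ`. -/
abbrev Pol3 (R : Type) [AddCommGroup R] : Type := ℕ →₀ (ℕ →₀ (ℕ →₀ R))

/-- Multiplication by the variable on `R[λ]`. -/
noncomputable def shift1 : Pol1 R → Pol1 R := Finsupp.mapDomain (· + 1)

/-- The action of `∂` on coefficients of `R[λ]`. -/
noncomputable def D1 (D : R →ₗ[ℂ] R) : Pol1 R → Pol1 R := Finsupp.mapRange D (map_zero D)

/-- The operator "multiplication by `-∂-λ`" on `R[λ]`. -/
noncomputable def subNeg (D : R →ₗ[ℂ] R) : Pol1 R → Pol1 R := fun z => -(D1 D z) - shift1 z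

/-- Evaluation of `f ∈ R[ν]` at the operator `e` (substitution `ν ↦ e`), inside `R[λ]`. -/
noncomputable def ev1 (f : Pol1 R) (e : Pol1 R → Pol1 R) : Pol1 R :=
  f.sum fun n r => e^[n] (Finsupp.single 0 r)

/-- Constants `R → R[λ,μ,γ]`. -/
noncomputable def iota3 : R → Pol3 R := fun r => Finsupp.single 0 (Finsupp.single 0 (Finsupp.single 0 r))

/-- Multiplication by `λ` on `R[λ,μ,γ]`. -/
noncomputable def Xl : Pol3 R → Pol3 R := Finsupp.mapDomain (· + 1)

/-- Multiplication by `μ` on `R[λ,μ,γ]`. -/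
noncomputable def Xm : Pol3 R → Pol3 R :=
  Finsupp.mapRange (Finsupp.mapDomain (· + 1)) Finsupp.mapDomain_zero

/-- Multiplication by `γ` on `R[λ,μ,γ]`. -/
noncomputable def Xg : Pol3 R → Pol3 R :=
  Finsupp.mapRange (Finsupp.mapRange (Finsupp.mapDomain (· + 1)) Finsupp.mapDomain_zero)
    Finsupp.mapRange_zero

/-- Multiplication by `λ+μ` on `R[λ,μ,γ]`. -/
noncomputable def eLM : Pol3 R → Pol3 R := fun z => Xl z + Xm z

/-- Multiplication by `μ+γ` on `R[λ,μ,γ]`. -/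
noncomputable def eMG : Pol3 R → Pol3 R := fun z => Xm z + Xg z

/-- Evaluation of `f ∈ R[ν]` at the operator `e` (substitution `ν ↦ e`), in `R[λ,μ,γ]`. -/
noncomputable def ev (f : Pol1 R) (e : Pol3 R → Pol3 R) : Pol3 R := f.sum fun n r => e^[n] (iota3 r)

/-- Extension of an `R`-argument operation `F` to a polynomial argument in `R[λ,μ,γ]`,
by ℂ[λ,μ,γ]-linearity. -/
noncomputable def lift3 (F : R → Pol3 R) : Pol3 R → Pol3 R := fun w =>
  w.sum fun a fa => fa.sum fun b fb => fb.sum fun c r => Xl^[a] (Xm^[b] (Xg^[c] (F r)))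

/-- `φ : R × R → R[λ]` is a conformal bilinear map: ℂ-bilinear with
`φ_λ(∂x,y) = -λ φ_λ(x,y)` and `φ_λ(x,∂y) = (∂+λ) φ_λ(x,y)`. -/
structure IsConfBilinear (D : R →ₗ[ℂ] R) (φ : R → R → Pol1 R) : Prop where
  add_left : ∀ x x' y, φ (x + x') y = φ x y + φ x' y
  add_right : ∀ x y y', φ x (y + y') = φ x y + φ x y'
  smul_left : ∀ (c : ℂ) x y, φ (c • x) y = c • φ x y
  smul_right : ∀ (c : ℂ) x y, φ x (c • y) = c • φ x y
  d_left : ∀ x y, φ (D x) y = -(shift1 (φ x y))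
  d_right : ∀ x y, φ x (D y) = D1 D (φ x y) + shift1 (φ x y)

/-- Skew-symmetry `φ_λ(x,y) = -φ_{-∂-λ}(y,x)`. -/
noncomputable def IsSkew (D : R →ₗ[ℂ] R) (φ : R → R → Pol1 R) : Prop :=
  ∀ x y, φ x y = -(ev1 (φ y x) (subNeg D))

/-- A Lie conformal algebra structure: conformal sesquilinearity, skew-symmetry and
the Jacobi identity `[x_λ[y_μ z]] = [[x_λ y]_{λ+μ} z] + [y_μ[x_λ z]]`. -/
structure IsLieConformal (D : R →ₗ[ℂ] R) (B : R → R → Pol1 R) : Prop where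
  bilin : IsConfBilinear D B
  skew : IsSkew D B
  jacobi : ∀ x y z,
    lift3 (fun r => ev (B x r) Xl) (ev (B y z) Xm)
      = lift3 (fun r => ev (B r z) eLM) (ev (B x y) Xl)
        + lift3 (fun r => ev (B y r) Xm) (ev (B x z) Xl)

/-- A conformal biderivation of a Lie conformal algebra `(R, D, B)`: a skew-symmetric
conformal bilinear map `φ` with `φ_λ(x,[y_μ z]) = [(φ_λ(x,y))_{λ+μ} z] + [y_μ φ_λ(x,z)]`. -/
structure IsConfBiderivation (D : R →ₗ[ℂ] R) (B : R → R → Pol1 R)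
    (φ : R → R → Pol1 R) : Prop where
  bilin : IsConfBilinear D φ
  skew : IsSkew D φ
  leibniz : ∀ x y z,
    lift3 (fun r => ev (φ x r) Xl) (ev (B y z) Xm)
      = lift3 (fun r => ev (B r z) eLM) (ev (φ x y) Xl)
        + lift3 (fun r => ev (B y r) Xm) (ev (φ x z) Xl)


/-- Coefficient finsupp of a polynomial. -/
noncomputable def toF {S : Type} [Semiring S] (p : Polynomial S) : ℕ →₀ S :=
  Finsupp.onFinset p.support (fun n => p.coeff n) (fun n h => Polynomial.mem_support_iff.mpr h)

/-- The loop `W(a,b)` conformal algebra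
`CLW(a,b) = (⊕_{i∈ℤ} ℂ[∂]L_i) ⊕ (⊕_{i∈ℤ} ℂ[∂]G_i)` as a free `ℂ[∂]`-module; the basis
element indexed by `(false, i)` is `L_i` and the one indexed by `(true, i)` is `G_i`. -/
abbrev WR : Type := (Bool × ℤ) →₀ Polynomial ℂ

/-- The action of `∂` on `CLW(a,b)`. -/
noncomputable def DW : WR →ₗ[ℂ] WR :=
  Finsupp.mapRange.linearMap (LinearMap.mulLeft ℂ (Polynomial.X : Polynomial ℂ))

/-- The basis element `L i`. -/
noncomputable def Lw (i : ℤ) : WR := Finsupp.single (false, i) (1 : Polynomial ℂ)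

/-- The basis element `G i`. -/
noncomputable def Gw (i : ℤ) : WR := Finsupp.single (true, i) (1 : Polynomial ℂ)

/-- `ℂ → ℂ[∂][λ]` (constants). -/
noncomputable def cc : ℂ →+* Polynomial (Polynomial ℂ) := Polynomial.C.comp Polynomial.C

/-- `∂` inside `ℂ[∂][λ]`. -/
noncomputable def vpd : Polynomial (Polynomial ℂ) := Polynomial.C Polynomial.X

/-- `λ` inside `ℂ[∂][λ]`. -/
noncomputable def vpl : Polynomial (Polynomial ℂ) := Polynomial.X

/-- The polynomial factor in the bracket of two basis elements:
`(∂+2λ)` for `[L,L]`, `(∂+(1-b)λ)` for `[L,G]`, `-(b∂+(b-1)λ)` for `[G,L]`,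
and `0` for `[G,G]`. -/
noncomputable def wFactor (b : ℂ) : Bool → Bool → Polynomial (Polynomial ℂ)
  | false, false => vpd + 2 * vpl
  | false, true => vpd + cc (1 - b) * vpl
  | true, false => -(cc b * vpd + cc (b - 1) * vpl)
  | true, true => 0

/-- The λ-bracket of `CLW(a,b)` (it depends only on `b`), determined by
`[L_i λ L_j] = (∂+2λ)L_{i+j}`, `[L_i λ G_j] = (∂+(1-b)λ)G_{i+j}`,
`[G_i λ L_j] = -(b∂+(b-1)λ)G_{i+j}`, `[G_i λ G_j] = 0`, and conformal sesquilinearity. -/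
noncomputable def BW (b : ℂ) (f g : WR) : Pol1 WR :=
  f.sum fun s p => g.sum fun t q =>
    Finsupp.mapRange (fun c => Finsupp.single (s.1 || t.1, s.2 + t.2) c)
      (Finsupp.single_zero _)
      (toF ((p.eval₂ cc (-vpl)) * (q.eval₂ cc (vpd + vpl)) * wFactor b s.1 t.1))

/-- The element `Σ_k a_{k-i-j} L_k` (if `s = false`) resp. `Σ_k a_{k-i-j} G_k`
(if `s = true`). -/
noncomputable def Sw (s : Bool) (a : ℤ →₀ ℂ) (i j : ℤ) : WR :=
  a.sum fun m c => Finsupp.single (s, m + i + j) (Polynomial.C c)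

/-- `(∂+cλ)·x ∈ CLW(a,b)[λ]`. -/
noncomputable def dcl (c : ℂ) (x : WR) : Pol1 WR :=
  Finsupp.single 0 (DW x) + Finsupp.single 1 (c • x)

section SubstitutionLemmas

variable {M : Type} [AddCommGroup M]

lemma shift1_add (f g : Pol1 M) : shift1 (f + g) = shift1 f + shift1 g :=
  Finsupp.mapDomain_add

lemma shift1_injective : Function.Injective (shift1 : Pol1 M → Pol1 M) :=
  Finsupp.mapDomain_injective (add_left_injective 1)

lemma shift1_neg (f : Pol1 M) : shift1 (-f) = -shift1 f :=
  map_neg (Finsupp.mapDomain.addMonoidHom (M := M) (· + 1 : ℕ → ℕ)) f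

lemma shift1_iterate_single (n : ℕ) (r : M) :
    shift1^[n] (Finsupp.single 0 r) = Finsupp.single n r := by
  induction n with
  | zero => rfl
  | succ n ih => rw [Function.iterate_succ_apply', ih]; exact Finsupp.mapDomain_single

lemma shift1_iterate_zero (n : ℕ) : shift1^[n] (0 : Pol1 M) = 0 :=
  Function.iterate_fixed Finsupp.mapDomain_zero n

/-- The specialization `μ = γ = 0`, as a map `M[λ,μ,γ] → M[λ]`. -/
noncomputable def specialize : Pol3 M →+ Pol1 M :=
  Finsupp.mapRange.addMonoidHom
    ((Finsupp.applyAddHom (M := M) (0 : ℕ)).comp (Finsupp.applyAddHom (M := ℕ →₀ M) (0 : ℕ)))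

lemma specialize_apply (v : Pol3 M) (n : ℕ) : specialize v n = v n 0 0 := rfl

lemma specialize_Xl (v : Pol3 M) : specialize (Xl v) = shift1 (specialize v) := by
  ext n
  rw [specialize_apply, Xl, shift1]
  rcases n with _ | n
  · rw [Finsupp.mapDomain_of_notMem_range _ _ (by simp), Finsupp.mapDomain_of_notMem_range _ _ (by simp)]
    rfl
  · rw [Finsupp.mapDomain_apply (add_left_injective 1) v n,
      Finsupp.mapDomain_apply (add_left_injective 1) _ n, specialize_apply]

lemma specialize_Xm (v : Pol3 M) : specialize (Xm v) = 0 := by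
  ext n
  rw [specialize_apply, Xm, Finsupp.mapRange_apply, Finsupp.mapDomain_of_notMem_range _ _ (by simp)]
  rfl

lemma specialize_Xg (v : Pol3 M) : specialize (Xg v) = 0 := by
  ext n
  rw [specialize_apply, Xg, Finsupp.mapRange_apply, Finsupp.mapRange_apply,
    Finsupp.mapDomain_of_notMem_range _ _ (by simp)]
  rfl

lemma specialize_eLM (v : Pol3 M) : specialize (eLM v) = shift1 (specialize v) := by
  rw [eLM, map_add, specialize_Xl, specialize_Xm, add_zero]

lemma specialize_iota3 (r : M) : specialize (iota3 r) = Finsupp.single 0 r := by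
  ext n
  rw [specialize_apply, iota3]
  rcases n with _ | n <;> simp

lemma specialize_iterate {e : Pol3 M → Pol3 M}
    (he : ∀ v, specialize (e v) = shift1 (specialize v)) (n : ℕ) (v : Pol3 M) :
    specialize (e^[n] v) = shift1^[n] (specialize v) := by
  induction n with
  | zero => rfl
  | succ n ih => rw [Function.iterate_succ_apply', he, ih, Function.iterate_succ_apply']

lemma specialize_ev {e : Pol3 M → Pol3 M}
    (he : ∀ v, specialize (e v) = shift1 (specialize v)) (f : Pol1 M) :
    specialize (ev f e) = f := by
  rw [ev, map_finsuppSum]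
  simp_rw [specialize_iterate he, specialize_iota3, shift1_iterate_single]
  exact Finsupp.sum_single f

lemma specialize_ev_Xm (f : Pol1 M) : specialize (ev f Xm) = Finsupp.single 0 (f 0) := by
  rw [ev, map_finsuppSum, Finsupp.sum, Finset.sum_eq_single 0]
  · simp [specialize_iota3]
  · intro n _ hn
    obtain ⟨m, rfl⟩ := Nat.exists_eq_succ_of_ne_zero hn
    rw [Function.iterate_succ_apply', specialize_Xm]
  · intro h
    rw [Finsupp.notMem_support_iff.mp h]
    simp [specialize_iota3]

lemma specialize_lift3 (F : M → Pol3 M) (hF : F 0 = 0) (w : Pol3 M) :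
    specialize (lift3 F w) = (specialize w).sum fun n r => shift1^[n] (specialize (F r)) := by
  have inner (fb : ℕ →₀ M) :
      specialize (fb.sum fun c r => Xg^[c] (F r)) = specialize (F (fb 0)) := by
    rw [map_finsuppSum, Finsupp.sum, Finset.sum_eq_single 0]
    · rfl
    · intro n _ hn
      obtain ⟨m, rfl⟩ := Nat.exists_eq_succ_of_ne_zero hn
      rw [Function.iterate_succ_apply', specialize_Xg]
    · intro h
      rw [Finsupp.notMem_support_iff.mp h, hF]
      rfl
  have middle (fa : ℕ →₀ ℕ →₀ M) :
      specialize (fa.sum fun b fb => fb.sum fun c r => Xm^[b] (Xg^[c] (F r)))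
        = specialize (F (fa 0 0)) := by
    rw [map_finsuppSum, Finsupp.sum, Finset.sum_eq_single 0]
    · exact inner _
    · intro n _ hn
      obtain ⟨m, rfl⟩ := Nat.exists_eq_succ_of_ne_zero hn
      rw [map_finsuppSum]
      simp_rw [Function.iterate_succ_apply', specialize_Xm]
      exact Finsupp.sum_fun_zero _
    · intro h
      rw [Finsupp.notMem_support_iff.mp h]
      simp
  have outer (n : ℕ) (fa : ℕ →₀ ℕ →₀ M) :
      specialize (fa.sum fun b fb => fb.sum fun c r => Xl^[n] (Xm^[b] (Xg^[c] (F r))))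
        = shift1^[n] (specialize (F (fa 0 0))) := by
    rw [← middle]
    let S : Pol1 M →+ Pol1 M := ⟨⟨shift1^[n], shift1_iterate_zero n⟩, fun f g =>
      Function.Semiconj₂.iterate (op := (· + ·)) shift1_add n f g⟩
    change _ = S _
    simp_rw [map_finsuppSum]
    simp_rw [specialize_iterate specialize_Xl]
    rfl
  rw [lift3, map_finsuppSum, specialize]
  simp_rw [Finsupp.mapRange.addMonoidHom_apply]
  rw [Finsupp.sum_mapRange_index]
  · exact Finsupp.sum_congr fun n _ => outer n _
  · intro n
    rw [hF]
    exact shift1_iterate_zero n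

/-- Evaluation of a polynomial in `λ` at `λ = -∂`. -/
noncomputable def evalNeg (D : R →ₗ[ℂ] R) : Pol1 R →+ R :=
  Finsupp.liftAddHom fun n => ((-D : Module.End ℂ R) ^ n).toAddMonoidHom

lemma evalNeg_single (D : R →ₗ[ℂ] R) (n : ℕ) (r : R) :
    evalNeg D (Finsupp.single n r) = ((-D : Module.End ℂ R) ^ n) r := by
  simp [evalNeg]

lemma evalNeg_subNeg (D : R →ₗ[ℂ] R) (f : Pol1 R) : evalNeg D (subNeg D f) = 0 := by
  rw [subNeg, map_sub, map_neg, sub_eq_zero]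
  induction f using Finsupp.induction_linear with
  | zero => simp [D1, shift1]
  | add f g hf hg =>
    rw [D1, Finsupp.mapRange_add (fun _ _ => map_add D _ _), shift1_add, map_add, map_add, neg_add]
    exact congrArg₂ _ hf hg
  | single n r =>
    rw [D1, Finsupp.mapRange_single, shift1, Finsupp.mapDomain_single, evalNeg_single,
      evalNeg_single, pow_succ, Module.End.mul_apply, LinearMap.neg_apply, map_neg]

lemma evalNeg_ev1_subNeg (D : R →ₗ[ℂ] R) (f : Pol1 R) :
    evalNeg D (ev1 f (subNeg D)) = f 0 := by
  rw [ev1, map_finsuppSum, Finsupp.sum, Finset.sum_eq_single 0]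
  · simp [evalNeg_single]
  · intro n _ hn
    obtain ⟨m, rfl⟩ := Nat.exists_eq_succ_of_ne_zero hn
    rw [Function.iterate_succ_apply', evalNeg_subNeg]
  · intro h
    rw [Finsupp.notMem_support_iff.mp h]
    simp

/-- If `[e_λ z]` has constant term `∂z` for all `z`, a conformal biderivation `φ` satisfies
`λ φ_λ(x,z) = -[φ_0(e,x)_λ z]`. -/
lemma IsConfBiderivation.shift1_eq {D : R →ₗ[ℂ] R} {B φ : R → R → Pol1 R}
    (hφ : IsConfBiderivation D B φ)
    (hadd : ∀ x x' y, B (x + x') y = B x y + B x' y)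
    (hD : ∀ x y, B (D x) y = -shift1 (B x y)) (hzero : ∀ x, B x 0 = 0)
    {e : R} (he : ∀ z, B e z 0 = D z) (x z : R) :
    shift1 (φ x z) = -B (φ e x 0) z := by
  let Bz : R →+ Pol1 R := AddMonoidHom.mk' (fun r => B r z) fun r r' => hadd r r' z
  have hφ0 : φ x 0 = 0 := by simpa using hφ.bilin.smul_right 0 x 0
  have hB0 : B 0 z = 0 := map_zero Bz
  have key := congrArg specialize (hφ.leibniz x e z)
  rw [map_add, specialize_lift3 _ (by simp [hφ0, ev]), specialize_lift3 _ (by simp [hB0, ev]),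
    specialize_lift3 _ (by simp [hzero, ev])] at key
  simp_rw [specialize_ev specialize_Xl, specialize_ev specialize_eLM, specialize_ev_Xm,
    he, shift1_iterate_single] at key
  rw [Finsupp.sum_single_index (by simp [hφ0]), Function.iterate_zero_apply,
    hφ.bilin.d_right] at key
  have hD1 : ((φ x z).sum fun n r => Finsupp.single n (D r)) = D1 D (φ x z) := by
    ext n
    rw [Finsupp.sum_apply, D1, Finsupp.mapRange_apply, Finsupp.sum, Finset.sum_eq_single n]
    · simp
    · intro m _ hm
      simp [hm]
    · intro h
      rw [Finsupp.notMem_support_iff.mp h]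
      simp
  have hpow (n : ℕ) (r : R) : shift1^[n] (B r z) = Bz (((-D : Module.End ℂ R) ^ n) r) := by
    induction n with
    | zero => rfl
    | succ n ih =>
      rw [Function.iterate_succ_apply', ih, pow_succ', Module.End.mul_apply, LinearMap.neg_apply,
        map_neg]
      exact (neg_eq_iff_eq_neg.mpr (hD _ z)).symm
  have hE : ((φ x e).sum fun n r => shift1^[n] (B r z)) = Bz (evalNeg D (φ x e)) := by
    simp_rw [hpow]
    rw [evalNeg, Finsupp.liftAddHom_apply, map_finsuppSum]
    rfl
  rw [hD1, hE, add_comm, add_left_inj, hφ.skew x e, map_neg, evalNeg_ev1_subNeg, map_neg] at key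
  exact key

end SubstitutionLemmas

section LoopAlgebra

/-- The value at `∂ = x`, `λ = y` of the coefficient of the basis element `κ`. -/
noncomputable def coeffEval (κ : Bool × ℤ) (x y : ℂ) : Pol1 WR →ₗ[ℂ] ℂ :=
  Finsupp.lsum ℂ fun n => y ^ n • (Polynomial.leval x ∘ₗ Finsupp.lapply κ)

lemma coeffEval_single (κ : Bool × ℤ) (x y : ℂ) (n : ℕ) (v : WR) :
    coeffEval κ x y (Finsupp.single n v) = y ^ n * (v κ).eval x := by
  simp [coeffEval, Polynomial.leval]

lemma coeffEval_zero_right (κ : Bool × ℤ) (x : ℂ) (f : Pol1 WR) :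
    coeffEval κ x 0 f = (f 0 κ).eval x := by
  induction f using Finsupp.induction_linear with
  | zero => simp
  | add f g hf hg => simp [hf, hg]
  | single n v =>
    rw [coeffEval_single]
    rcases n with _ | n <;> simp

lemma coeffEval_shift1 (κ : Bool × ℤ) (x y : ℂ) (f : Pol1 WR) :
    coeffEval κ x y (shift1 f) = y * coeffEval κ x y f := by
  induction f using Finsupp.induction_linear with
  | zero => simp [shift1]
  | add f g hf hg => rw [shift1_add, map_add, map_add, hf, hg, mul_add]
  | single n v =>
    rw [shift1, Finsupp.mapDomain_single, coeffEval_single, coeffEval_single]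
    ring

lemma DW_apply (v : WR) (κ : Bool × ℤ) : DW v κ = Polynomial.X * v κ := rfl

lemma coeffEval_D1 (κ : Bool × ℤ) (x y : ℂ) (f : Pol1 WR) :
    coeffEval κ x y (D1 DW f) = x * coeffEval κ x y f := by
  induction f using Finsupp.induction_linear with
  | zero => simp [D1]
  | add f g hf hg =>
    rw [D1, Finsupp.mapRange_add (fun _ _ => map_add DW _ _), map_add, map_add, mul_add]
    exact congrArg₂ _ hf hg
  | single n v =>
    rw [D1, Finsupp.mapRange_single, coeffEval_single, coeffEval_single, DW_apply,
      Polynomial.eval_mul, Polynomial.eval_X]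
    ring

lemma coeffEval_ev1_subNeg (κ : Bool × ℤ) (x y : ℂ) (f : Pol1 WR) :
    coeffEval κ x y (ev1 f (subNeg DW)) = coeffEval κ x (-x - y) f := by
  have iter (n : ℕ) (g : Pol1 WR) :
      coeffEval κ x y ((subNeg DW)^[n] g) = (-x - y) ^ n * coeffEval κ x y g := by
    induction n with
    | zero => simp
    | succ n ih =>
      rw [Function.iterate_succ_apply', subNeg, map_sub, map_neg, coeffEval_D1, coeffEval_shift1,
        ih]
      ring
  rw [ev1, map_finsuppSum]
  simp_rw [iter, coeffEval_single]
  simp only [coeffEval, Finsupp.lsum_apply, pow_zero, one_mul]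
  rfl

lemma coeffEval_ext {f g : Pol1 WR} (h : ∀ κ x y, coeffEval κ x y f = coeffEval κ x y g) :
    f = g := by
  rw [← sub_eq_zero]
  have h0 κ x y : coeffEval κ x y (f - g) = 0 := by rw [map_sub, h, sub_self]
  generalize f - g = d at h0
  ext1 n
  ext1 κ
  refine Polynomial.funext fun x => ?_
  have hp : (d.sum fun n v => Polynomial.monomial n ((v κ).eval x)) = 0 := by
    refine Polynomial.funext fun y => ?_
    rw [Finsupp.sum, Polynomial.eval_finsetSum, Polynomial.eval_zero, ← h0 κ x y]
    simp [coeffEval, Polynomial.leval, Finsupp.sum, mul_comm]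
  have hc := congrArg (Polynomial.coeff · n) hp
  simp only [Finsupp.sum, Polynomial.finsetSum_coeff, Polynomial.coeff_monomial,
    Polynomial.coeff_zero, Finset.sum_ite_eq'] at hc
  by_cases hn : n ∈ d.support
  · simpa [hn] using hc
  · rw [Finsupp.notMem_support_iff.mp hn]
    rfl

/-- The value of `wFactor` at `∂ = x`, `λ = y`. -/
noncomputable def wEval (b : ℂ) (s t : Bool) (x y : ℂ) : ℂ := (wFactor b s t).evalEval x y

lemma wEval_false_false (b x y : ℂ) : wEval b false false x y = x + 2 * y := by
  simp [wEval, wFactor, vpd, vpl, Polynomial.evalEval]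

lemma wEval_false_true (b x y : ℂ) : wEval b false true x y = x + (1 - b) * y := by
  simp [wEval, wFactor, vpd, vpl, cc, Polynomial.evalEval]

lemma wEval_true_false (b x y : ℂ) : wEval b true false x y = -(b * x + (b - 1) * y) := by
  simp [wEval, wFactor, vpd, vpl, cc, Polynomial.evalEval]

lemma wEval_true_true (b x y : ℂ) : wEval b true true x y = 0 := by
  simp [wEval, wFactor, Polynomial.evalEval]

/-- The contribution of a pair of monomials to the bracket, evaluated at `∂ = x`, `λ = y`. -/
noncomputable def bracketTerm (b : ℂ) (κ : Bool × ℤ) (x y : ℂ) (s : Bool × ℤ) (p : Polynomial ℂ)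
    (t : Bool × ℤ) (q : Polynomial ℂ) : ℂ :=
  if (s.1 || t.1, s.2 + t.2) = κ then p.eval (-y) * q.eval (x + y) * wEval b s.1 t.1 x y else 0

lemma evalEval_eval₂_cc (p : Polynomial ℂ) (r : Polynomial (Polynomial ℂ)) (x y : ℂ) :
    (p.eval₂ cc r).evalEval x y = p.eval (r.evalEval x y) := by
  induction p using Polynomial.induction_on' with
  | add p q hp hq =>
    rw [Polynomial.eval₂_add, Polynomial.evalEval_add, hp, hq, Polynomial.eval_add]
  | monomial n c =>
    rw [Polynomial.eval₂_monomial, Polynomial.evalEval_mul, Polynomial.evalEval_pow,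
      Polynomial.eval_monomial]
    simp [cc]

lemma coeffEval_mapRange_toF (κ s : Bool × ℤ) (x y : ℂ) (P : Polynomial (Polynomial ℂ)) :
    coeffEval κ x y (Finsupp.mapRange (fun c => Finsupp.single s c) (Finsupp.single_zero _) (toF P))
      = if s = κ then P.evalEval x y else 0 := by
  rw [coeffEval, Finsupp.lsum_apply, Finsupp.sum_mapRange_index (by simp)]
  have hs : (toF P).support = P.support := by
    ext n
    simp [toF]
  split_ifs with h
  · rw [Finsupp.sum, hs, Polynomial.evalEval, Polynomial.eval_eq_sum (p := P), Polynomial.sum,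
      Polynomial.eval_finsetSum]
    simp [h, toF, Polynomial.leval, mul_comm]
  · simp [h, Finsupp.sum]

lemma coeffEval_BW (b : ℂ) (κ : Bool × ℤ) (x y : ℂ) (f g : WR) :
    coeffEval κ x y (BW b f g) = f.sum fun s p => g.sum fun t q => bracketTerm b κ x y s p t q := by
  rw [BW, map_finsuppSum]
  refine Finsupp.sum_congr fun s _ => ?_
  rw [map_finsuppSum]
  refine Finsupp.sum_congr fun t _ => ?_
  rw [coeffEval_mapRange_toF, bracketTerm, Polynomial.evalEval_mul, Polynomial.evalEval_mul,
    evalEval_eval₂_cc, evalEval_eval₂_cc]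
  simp [vpl, vpd, wEval, Polynomial.evalEval]

lemma coeffEval_BW_single_right (b : ℂ) (κ : Bool × ℤ) (x y : ℂ) (f : WR) (t : Bool × ℤ) :
    coeffEval κ x y (BW b f (Finsupp.single t 1))
      = f.sum fun s p => bracketTerm b κ x y s p t 1 := by
  rw [coeffEval_BW]
  exact Finsupp.sum_congr fun s _ => Finsupp.sum_single_index (by simp [bracketTerm])

lemma BW_add_left (b : ℂ) (f f' g : WR) : BW b (f + f') g = BW b f g + BW b f' g := by
  refine coeffEval_ext fun κ x y => ?_
  rw [map_add, coeffEval_BW, coeffEval_BW, coeffEval_BW, Finsupp.sum_add_index']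
  · simp [bracketTerm]
  · intro s p q
    rw [← Finsupp.sum_add]
    refine Finsupp.sum_congr fun t _ => ?_
    simp only [bracketTerm]
    split_ifs
    · rw [Polynomial.eval_add]
      ring
    · simp

lemma BW_D_left (b : ℂ) (f g : WR) : BW b (DW f) g = -shift1 (BW b f g) := by
  refine coeffEval_ext fun κ x y => ?_
  rw [map_neg, coeffEval_shift1, coeffEval_BW, coeffEval_BW, DW,
    Finsupp.mapRange.linearMap_apply, Finsupp.sum_mapRange_index (by simp [bracketTerm]),
    Finsupp.mul_sum, ← Finsupp.sum_neg]
  refine Finsupp.sum_congr fun s _ => ?_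
  rw [Finsupp.mul_sum, ← Finsupp.sum_neg]
  refine Finsupp.sum_congr fun t _ => ?_
  simp only [bracketTerm, LinearMap.mulLeft_apply, Polynomial.eval_mul, Polynomial.eval_X]
  split_ifs <;> ring

lemma BW_zero_right (b : ℂ) (f : WR) : BW b f 0 = 0 := by simp [BW]

lemma BW_Lw_zero (b : ℂ) (z : WR) : BW b (Lw 0) z 0 = DW z := by
  ext1 κ
  refine Polynomial.funext fun x => ?_
  rw [← coeffEval_zero_right, coeffEval_BW, Lw, Finsupp.sum_single_index (by simp [bracketTerm]),
    DW_apply, Polynomial.eval_mul, Polynomial.eval_X, Finsupp.sum, Finset.sum_eq_single κ]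
  · rcases κ with ⟨_ | _, k⟩ <;>
      simp [bracketTerm, wEval_false_false, wEval_false_true, mul_comm]
  · intro t _ ht
    simp [bracketTerm, ht]
  · intro h
    rw [Finsupp.notMem_support_iff.mp h]
    simp [bracketTerm]

lemma coeffEval_BW_Lw_zero_right (b : ℂ) (σ : Bool) (k : ℤ) (x y : ℂ) (f : WR) :
    coeffEval (σ, k) x y (BW b f (Lw 0)) = (f (σ, k)).eval (-y) * wEval b σ false x y := by
  rw [Lw, coeffEval_BW_single_right, Finsupp.sum, Finset.sum_eq_single (σ, k)]
  · simp [bracketTerm]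
  · intro t _ ht
    simp [bracketTerm, ht]
  · intro h
    rw [Finsupp.notMem_support_iff.mp h]
    simp [bracketTerm]

lemma coeffEval_dcl (κ : Bool × ℤ) (c x y : ℂ) (v : WR) :
    coeffEval κ x y (dcl c v) = (v κ).eval x * (x + c * y) := by
  rw [dcl, map_add, coeffEval_single, coeffEval_single, DW_apply]
  simp
  ring

lemma eval_Sw_apply (σ : Bool) (a : ℤ →₀ ℂ) (i j : ℤ) (κ : Bool × ℤ) (x : ℂ) :
    (Sw σ a i j κ).eval x = a.sum fun m c => if (σ, m + i + j) = κ then c else 0 := by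
  rw [Sw, Finsupp.sum_apply, Finsupp.sum, Polynomial.eval_finsetSum]
  refine Finset.sum_congr rfl fun m _ => ?_
  rw [Finsupp.single_apply, apply_ite (Polynomial.eval x)]
  simp only [Polynomial.eval_C, Polynomial.eval_zero]

lemma coeffEval_BW_Sw (b : ℂ) (σ τ : Bool) (a : ℤ →₀ ℂ) (i j : ℤ) (κ : Bool × ℤ) (x y : ℂ) :
    coeffEval κ x y (BW b (Sw σ a i 0) (Finsupp.single (τ, j) 1))
      = (Sw (σ || τ) a i j κ).eval x * wEval b σ τ x y := by
  rw [coeffEval_BW_single_right, Sw, Finsupp.sum_sum_index (by simp [bracketTerm])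
    (by intro s p q; simp only [bracketTerm]; split_ifs <;> simp [add_mul]), eval_Sw_apply,
    Finsupp.sum_mul]
  refine Finsupp.sum_congr fun m _ => ?_
  rw [Finsupp.sum_single_index (by simp [bracketTerm])]
  simp [bracketTerm]

lemma BW_Sw_Lw (b : ℂ) (a : ℤ →₀ ℂ) (i j : ℤ) :
    BW b (Sw false a i 0) (Lw j) = dcl 2 (Sw false a i j) := by
  refine coeffEval_ext fun κ x y => ?_
  rw [Lw, coeffEval_BW_Sw, coeffEval_dcl, wEval_false_false]
  rfl

lemma BW_Sw_Gw (b : ℂ) (a : ℤ →₀ ℂ) (i j : ℤ) :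
    BW b (Sw false a i 0) (Gw j) = dcl (1 - b) (Sw true a i j) := by
  refine coeffEval_ext fun κ x y => ?_
  rw [Gw, coeffEval_BW_Sw, coeffEval_dcl, wEval_false_true]
  rfl

lemma BW_Sw_true_Gw (b : ℂ) (a : ℤ →₀ ℂ) (i j : ℤ) :
    BW b (Sw true a i 0) (Gw j) = 0 := by
  refine coeffEval_ext fun κ x y => ?_
  rw [Gw, coeffEval_BW_Sw, wEval_true_true, mul_zero, map_zero]

lemma dcl_apply_zero (c : ℂ) (v : WR) : dcl c v 0 = DW v := by simp [dcl]

lemma Sw_zero_left (σ : Bool) (a : ℤ →₀ ℂ) (i : ℤ) : Sw σ a 0 i = Sw σ a i 0 := by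
  simp [Sw]

/-- For a conformal biderivation `φ` with `b ≠ -1`, the constant term of `φ_λ(L_0,L_0)` is
`∂` applied to a ℂ-linear combination of the `L_k`. -/
lemma exists_constant_term {b : ℂ} (hb : b ≠ -1) {φ : WR → WR → Pol1 WR}
    (hφ : IsConfBiderivation DW (BW b) φ) :
    ∃ a : ℤ →₀ ℂ, φ (Lw 0) (Lw 0) 0 = DW (Sw false a 0 0) := by
  set f := φ (Lw 0) (Lw 0) with hf
  set w : WR := f 0 with hw
  have hshift := hφ.shift1_eq (BW_add_left b) (BW_D_left b) (BW_zero_right b) (BW_Lw_zero b)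
    (Lw 0) (Lw 0)
  rw [← hf, ← hw] at hshift
  have hval (σ : Bool) (k : ℤ) (x y : ℂ) :
      y * coeffEval (σ, k) x y f = -((w (σ, k)).eval (-y) * wEval b σ false x y) := by
    rw [← coeffEval_shift1, hshift, map_neg, coeffEval_BW_Lw_zero_right]
  have hskew (σ : Bool) (k : ℤ) (x y : ℂ) :
      coeffEval (σ, k) x y f = -coeffEval (σ, k) x (-x - y) f := by
    conv_lhs => rw [hf, hφ.skew, ← hf, map_neg, coeffEval_ev1_subNeg]
  have hsym (σ : Bool) (k : ℤ) (s t : ℂ) :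
      (w (σ, k)).eval s * wEval b σ false (s + t) (-s) * t
        = -((w (σ, k)).eval t * wEval b σ false (s + t) (-t) * s) := by
    have h1 := hval σ k (s + t) (-s)
    have h2 := hval σ k (s + t) (-t)
    have h3 := hskew σ k (s + t) (-s)
    rw [show -(s + t) - -s = -t by ring] at h3
    rw [neg_neg] at h1 h2
    linear_combination t * h1 + s * h2 + s * t * h3
  have hG (k : ℤ) : w (true, k) = 0 := by
    refine Polynomial.eq_zero_of_infinite_isRoot _
      ((Set.finite_singleton (0 : ℂ)).infinite_compl.mono fun s hs => ?_)
    have h := hsym true k s s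
    rw [wEval_true_false] at h
    have hs0 : s ≠ 0 := hs
    have hb1 : b + 1 ≠ 0 := fun h => hb (eq_neg_of_add_eq_zero_left h)
    have h' : (w (true, k)).eval s * ((b + 1) * s ^ 2) = 0 := by linear_combination -h / 2
    exact (mul_eq_zero.mp h').resolve_right (mul_ne_zero hb1 (pow_ne_zero 2 hs0))
  have hL (k : ℤ) (t : ℂ) : (w (false, k)).eval t = t * (w (false, k)).eval 1 := by
    by_cases ht : t = 1
    · rw [ht, one_mul]
    have h := hsym false k 1 t
    rw [wEval_false_false, wEval_false_false] at h
    refine mul_right_cancel₀ (sub_ne_zero.mpr ht) ?_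
    linear_combination -h
  refine ⟨(w.comapDomain (fun k : ℤ => (false, k))
    (Function.Injective.injOn fun _ _ h => (Prod.mk.inj h).2)).mapRange
      (Polynomial.eval 1) Polynomial.eval_zero, ?_⟩
  ext1 κ
  refine Polynomial.funext fun x => ?_
  rw [DW_apply, Polynomial.eval_mul, Polynomial.eval_X, eval_Sw_apply]
  rcases κ with ⟨_ | _, k⟩
  · rw [hL, Finsupp.sum, Finset.sum_eq_single k]
    · simp
    · intro m _ hm
      simp [hm]
    · intro h
      simpa using Finsupp.notMem_support_iff.mp h
  · rw [hG]
    simp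

end LoopAlgebra

/-- if `b ≠ -1` and `φ` is a conformal biderivation of `CLW(a,b)`, then
there is a finitely supported family `(a_k)_{k∈ℤ}` of complex numbers with
`φ_λ(L_i,L_j) = (∂+2λ) Σ_k a_{k-i-j} L_k`, `φ_λ(G_i,G_j) = 0` and
`φ_λ(L_i,G_j) = (∂+(1-b)λ) Σ_k a_{k-i-j} G_k` for all `i, j ∈ ℤ`. -/
theorem clw_biderivation_classification (a b : ℂ) (hb : b ≠ -1)
    (φ : WR → WR → Pol1 WR) (hφ : IsConfBiderivation DW (BW b) φ) :
    ∃ ak : ℤ →₀ ℂ, ∀ i j : ℤ,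
      φ (Lw i) (Lw j) = dcl 2 (Sw false ak i j)
        ∧ φ (Gw i) (Gw j) = 0
        ∧ φ (Lw i) (Gw j) = dcl (1 - b) (Sw true ak i j) := by
  obtain ⟨ak, hak⟩ := exists_constant_term hb hφ
  have hshift := hφ.shift1_eq (BW_add_left b) (BW_D_left b) (BW_zero_right b) (BW_Lw_zero b)
  have hlift {x u : WR} (hx : φ (Lw 0) x 0 = DW u) (z : WR) : φ x z = BW b u z :=
    shift1_injective (by rw [hshift, hx, BW_D_left, neg_neg])
  have hL (i : ℤ) : φ (Lw 0) (Lw i) 0 = DW (Sw false ak i 0) := by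
    rw [hlift hak, BW_Sw_Lw, dcl_apply_zero, Sw_zero_left]
  have hG (i : ℤ) : φ (Lw 0) (Gw i) 0 = DW (Sw true ak i 0) := by
    rw [hlift hak, BW_Sw_Gw, dcl_apply_zero, Sw_zero_left]
  refine ⟨ak, fun i j => ⟨?_, ?_, ?_⟩⟩
  · rw [hlift (hL i), BW_Sw_Lw]
  · rw [hlift (hG i), BW_Sw_true_Gw]
  · rw [hlift (hL i), BW_Sw_Gw]

end ConfBider
end

section
/- Let φ be a conformal biderivation of the loop Virasoro Lie conformal algebra CW, and write φ_λ(L_i,L_j) = (∂+2λ)Σ_{k∈Z} f^k_{i,j} L_k with f^k_{i,j} ∈ C. Then the coefficients satisfy the shift relation f^k_{i,j} = f^{k+m+n-i-j}_{m,n} for all i, j, k, m, n ∈ Z; in particular f^k_{i,j} = f^{k+i+j}_{0,0} depends only on k - i - j up to reindexing. -/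
/- Framework: a Lie conformal algebra over ℂ is a ℂ[∂]-module `R` (given by a ℂ-module
with a ℂ-linear operator `D` for the action of `∂`) with a λ-bracket `B : R → R → R[λ]`.
We model `R[λ]` as `ℕ →₀ R` (coefficient of `λ^n` at index `n`) and `R[λ,μ,γ]` as an
iterated Finsupp.  Substitutions of the bracket variable are implemented by evaluating
the polynomial at a commuting operator (e.g. multiplication by `λ`, by `λ+μ`, or by
`-∂-λ`), and brackets/biderivations are extended to polynomial-valued arguments by
ℂ[λ,μ,γ]-bilinearity. -/

namespace ConfBider

variable {R : Type} [AddCommGroup R] [Module ℂ R]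

/-- The loop Virasoro conformal algebra `CW = ⊕_{i∈ℤ} ℂ[∂]L_i` as a free `ℂ[∂]`-module. -/
abbrev CWR : Type := ℤ →₀ Polynomial ℂ

/-- The action of `∂` on `CW`. -/
noncomputable def DCW : CWR →ₗ[ℂ] CWR :=
  Finsupp.mapRange.linearMap (LinearMap.mulLeft ℂ (Polynomial.X : Polynomial ℂ))

/-- The basis element `L i`. -/
noncomputable def Lcw (i : ℤ) : CWR := Finsupp.single i (1 : Polynomial ℂ)

/-- The λ-bracket of `CW`, determined by `[L_i λ L_j] = (∂+2λ)L_{i+j}` and conformal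
sesquilinearity: `[p(∂)L_i λ q(∂)L_j] = p(-λ)q(∂+λ)(∂+2λ)L_{i+j}`. -/
noncomputable def BCW (f g : CWR) : Pol1 CWR :=
  f.sum fun i p => g.sum fun j q =>
    Finsupp.mapRange (fun c => Finsupp.single (i + j) c) (Finsupp.single_zero _)
      (toF ((p.eval₂ cc (-vpl)) * (q.eval₂ cc (vpd + vpl)) * (vpd + 2 * vpl)))

/-- The element `Σ_k a_{k-i-j} L_k ∈ CW` for a finitely supported family `a`. -/
noncomputable def Scw (a : ℤ →₀ ℂ) (i j : ℤ) : CWR :=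
  a.sum fun m c => Finsupp.single (m + i + j) (Polynomial.C c)

/-- `(∂+2λ)·x ∈ CW[λ]`. -/
noncomputable def d2l (x : CWR) : Pol1 CWR :=
  Finsupp.single 0 (DCW x) + Finsupp.single 1 ((2 : ℂ) • x)

/-- The element `Σ_k f^k L_k ∈ CW` for a finitely supported family `f`. -/
noncomputable def Tcw (f : ℤ →₀ ℂ) : CWR :=
  f.sum fun k c => Finsupp.single k (Polynomial.C c)

section ConstantTerms

lemma sum_eq_apply_zero {M N : Type*} [Zero M] [AddCommMonoid N] (w : ℕ →₀ M) (h : ℕ → M → N)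
    (h0 : h 0 0 = 0) (hs : ∀ a x, a ≠ 0 → h a x = 0) : w.sum h = h 0 (w 0) := by
  rw [Finsupp.sum, Finset.sum_eq_single 0]
  · exact fun a _ ha => hs a _ ha
  · intro h'
    rw [Finsupp.notMem_support_iff.mp h', h0]

lemma mapDomain_succ_zero {M : Type*} [AddCommMonoid M] (z : ℕ →₀ M) :
    Finsupp.mapDomain (· + 1) z 0 = 0 :=
  Finsupp.mapDomain_of_notMem_range _ _ (by simp)

/-- The constant term of an element of `R[λ,μ,γ]`. -/
noncomputable def constTerm (M : Type) [AddCommGroup M] : Pol3 M →+ M :=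
  (Finsupp.applyAddHom 0).comp ((Finsupp.applyAddHom 0).comp (Finsupp.applyAddHom 0))

lemma constTerm_Xl {M : Type} [AddCommGroup M] (z : Pol3 M) : constTerm M (Xl z) = 0 := by
  simp [constTerm, Xl, mapDomain_succ_zero]

lemma constTerm_Xm {M : Type} [AddCommGroup M] (z : Pol3 M) : constTerm M (Xm z) = 0 := by
  simp [constTerm, Xm, mapDomain_succ_zero]

lemma constTerm_Xg {M : Type} [AddCommGroup M] (z : Pol3 M) : constTerm M (Xg z) = 0 := by
  simp [constTerm, Xg, mapDomain_succ_zero]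

lemma constTerm_eLM {M : Type} [AddCommGroup M] (z : Pol3 M) : constTerm M (eLM z) = 0 := by
  simp [eLM, constTerm_Xl, constTerm_Xm]

lemma constTerm_iota3 {M : Type} [AddCommGroup M] (r : M) : constTerm M (iota3 r) = r := by
  simp [constTerm, iota3]

lemma constTerm_iterate {M : Type} [AddCommGroup M]
    {e : Pol3 M → Pol3 M} (he : ∀ z, constTerm M (e z) = 0) {n : ℕ}
    (hn : n ≠ 0) (z : Pol3 M) : constTerm M (e^[n] z) = 0 := by
  obtain ⟨m, rfl⟩ := Nat.exists_eq_succ_of_ne_zero hn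
  rw [Function.iterate_succ_apply', he]

lemma constTerm_ev {M : Type} [AddCommGroup M]
    (f : Pol1 M) {e : Pol3 M → Pol3 M} (he : ∀ z, constTerm M (e z) = 0) :
    constTerm M (ev f e) = f 0 := by
  rw [ev, map_finsuppSum, sum_eq_apply_zero]
  · simp [constTerm_iota3]
  · simp [constTerm_iota3]
  · exact fun a x ha => constTerm_iterate he ha _

lemma constTerm_lift3 {M : Type} [AddCommGroup M]
    (F : M → Pol3 M) (hF : constTerm M (F 0) = 0) (w : Pol3 M) :
    constTerm M (lift3 F w) = constTerm M (F (constTerm M w)) := by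
  have hX : ∀ a b c r, (a ≠ 0 ∨ b ≠ 0 ∨ c ≠ 0) →
      constTerm M (Xl^[a] (Xm^[b] (Xg^[c] (F r)))) = 0 := by
    intro a b c r h
    by_cases ha : a = 0
    · subst ha
      by_cases hb : b = 0
      · subst hb
        exact constTerm_iterate constTerm_Xg (by simpa using h) _
      · exact constTerm_iterate constTerm_Xm hb _
    · exact constTerm_iterate constTerm_Xl ha _
  simp only [lift3, map_finsuppSum]
  rw [sum_eq_apply_zero, sum_eq_apply_zero, sum_eq_apply_zero]
  · rfl
  · exact hF
  · exact fun c r hc => hX _ _ _ _ (by simp [hc])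
  · simp
  · exact fun b g hb => Finset.sum_eq_zero fun c _ => hX _ _ _ _ (by simp [hb])
  · simp
  · exact fun a g ha => Finset.sum_eq_zero fun b _ => Finset.sum_eq_zero fun c _ =>
      hX _ _ _ _ (by simp [ha])

/-- The constant term of the Leibniz rule: `φ_0(x,[y_0 z]) = [φ_0(x,y)_0 z] + [y_0 φ_0(x,z)]`. -/
lemma IsConfBiderivation.leibniz_zero {D : R →ₗ[ℂ] R} {B φ : R → R → Pol1 R}
    (hφ : IsConfBiderivation D B φ) (hl : ∀ z, B 0 z = 0) (hr : ∀ y, B y 0 = 0) (x y z : R) :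
    φ x (B y z 0) 0 = B (φ x y 0) z 0 + B y (φ x z 0) 0 := by
  have hφ0 : φ x 0 = 0 := by simpa using hφ.bilin.smul_right 0 x 0
  have h := congrArg (constTerm R) (hφ.leibniz x y z)
  rwa [map_add, constTerm_lift3, constTerm_lift3, constTerm_lift3,
    constTerm_ev _ constTerm_Xl, constTerm_ev _ constTerm_Xl, constTerm_ev _ constTerm_Xl,
    constTerm_ev _ constTerm_Xm, constTerm_ev _ constTerm_Xm, constTerm_ev _ constTerm_eLM] at h
  all_goals first
    | rw [constTerm_ev _ constTerm_Xl, hφ0, Finsupp.zero_apply]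
    | rw [constTerm_ev _ constTerm_Xm, hr, Finsupp.zero_apply]
    | rw [constTerm_ev _ constTerm_eLM, hl, Finsupp.zero_apply]

end ConstantTerms

lemma DCW_apply (x : CWR) (k : ℤ) : DCW x k = Polynomial.X * x k := rfl

lemma Tcw_apply (f : ℤ →₀ ℂ) (k : ℤ) : Tcw f k = Polynomial.C (f k) := by
  rw [Tcw, Finsupp.sum_apply, Finsupp.sum, Finset.sum_eq_single k]
  · simp
  · intro b _ hb
    simp [hb]
  · intro h
    simp [Finsupp.notMem_support_iff.mp h]

lemma d2l_apply_zero (x : CWR) : d2l x 0 = DCW x := by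
  simp [d2l]

lemma BCW_apply_zero (f g : CWR) :
    BCW f g 0 = f.sum fun i p => g.sum fun j q =>
      Finsupp.single (i + j) (Polynomial.C (p.coeff 0) * q * Polynomial.X) := by
  have hc : (Polynomial.evalRingHom (0 : Polynomial ℂ)).comp cc = Polynomial.C := by
    ext; simp [cc]
  have hp (p : Polynomial ℂ) :
      (p.eval₂ cc (-vpl)).coeff 0 = Polynomial.C (p.coeff 0) := by
    have h := Polynomial.hom_eval₂ p cc (Polynomial.evalRingHom (0 : Polynomial ℂ)) (-vpl)
    rw [Polynomial.coeff_zero_eq_eval_zero, ← Polynomial.coe_evalRingHom, h, hc]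
    simp [vpl, Polynomial.eval₂_at_zero]
  have hq (q : Polynomial ℂ) : (q.eval₂ cc (vpd + vpl)).coeff 0 = q := by
    have h := Polynomial.hom_eval₂ q cc (Polynomial.evalRingHom (0 : Polynomial ℂ)) (vpd + vpl)
    rw [Polynomial.coeff_zero_eq_eval_zero, ← Polynomial.coe_evalRingHom, h, hc]
    simp [vpl, vpd, Polynomial.eval₂_C_X]
  simp only [BCW, Finsupp.sum_apply]
  refine Finset.sum_congr rfl fun i _ => Finset.sum_congr rfl fun j _ => ?_
  simp only [toF, Finsupp.mapRange_apply, Finsupp.onFinset_apply, Polynomial.mul_coeff_zero, hp, hq]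
  congr 2
  simp [vpd, vpl]

lemma BCW_DCW_left_apply_zero (x z : CWR) : BCW (DCW x) z 0 = 0 := by
  rw [BCW_apply_zero]
  refine Finset.sum_eq_zero fun i _ => Finset.sum_eq_zero fun j _ => ?_
  simp [DCW_apply]

lemma BCW_Lcw_left_apply_zero (y : ℤ) (x : CWR) (k : ℤ) :
    BCW (Lcw y) x 0 k = Polynomial.X * x (k - y) := by
  rw [BCW_apply_zero, Lcw, Finsupp.sum_single_index (by simp), Finsupp.sum_apply, Finsupp.sum,
    Finset.sum_eq_single (k - y)]
  · simp [mul_comm]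
  · intro b _ hb
    rw [Finsupp.single_eq_of_ne]
    omega
  · intro h
    simp [Finsupp.notMem_support_iff.mp h]

lemma BCW_Lcw_Lcw_apply_zero (y z : ℤ) : BCW (Lcw y) (Lcw z) 0 = DCW (Lcw (y + z)) := by
  ext1 k
  rw [BCW_Lcw_left_apply_zero, DCW_apply, Lcw, Lcw, Finsupp.single_apply, Finsupp.single_apply]
  congr 2
  apply propext
  omega

/-- `subNeg` as an additive map. -/
noncomputable def subNegHom (D : R →ₗ[ℂ] R) : Pol1 R →+ Pol1 R :=
  AddMonoidHom.mk' (subNeg D) fun x y => by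
    have h₁ : D1 D (x + y) = D1 D x + D1 D y := Finsupp.mapRange_add (map_add D) x y
    have h₂ : shift1 (x + y) = shift1 x + shift1 y := Finsupp.mapDomain_add
    rw [subNeg, subNeg, subNeg, h₁, h₂]
    abel

lemma ev1_d2l_apply_zero (x : CWR) : ev1 (d2l x) (subNeg DCW) 0 = -DCW x := by
  rw [ev1, d2l, Finsupp.sum_add_index']
  · rw [Finsupp.sum_single_index (by simp), Finsupp.sum_single_index]
    · simp [subNeg, D1, shift1, mapDomain_succ_zero, two_smul]
    · simp [subNeg, D1, shift1]
  · intro n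
    rw [Finsupp.single_zero]
    exact iterate_map_zero (subNegHom DCW) n
  · intro n r s
    rw [Finsupp.single_add]
    exact iterate_map_add (subNegHom DCW) n _ _

/-- if `φ` is a conformal biderivation of the loop Virasoro Lie conformal
algebra `CW` with `φ_λ(L_i,L_j) = (∂+2λ) Σ_{k∈ℤ} f^k_{i,j} L_k`, then the coefficients
satisfy the shift relation `f^k_{i,j} = f^{k+m+n-i-j}_{m,n}` for all `i,j,k,m,n ∈ ℤ`. -/
theorem cw_biderivation_shift (φ : CWR → CWR → Pol1 CWR)
    (hφ : IsConfBiderivation DCW BCW φ) (f : ℤ → ℤ → (ℤ →₀ ℂ))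
    (hf : ∀ i j : ℤ, φ (Lcw i) (Lcw j) = d2l (Tcw (f i j))) :
    ∀ i j k m n : ℤ, f i j k = f m n (k + m + n - i - j) := by
  have hD (x y : CWR) (h : DCW x = DCW y) (k : ℤ) : x k = y k :=
    mul_left_cancel₀ Polynomial.X_ne_zero (DFunLike.congr_fun h k)
  have hsymm (i j k : ℤ) : f i j k = f j i k := by
    have h := DFunLike.congr_fun (hφ.skew (Lcw i) (Lcw j)) 0
    rw [Finsupp.neg_apply, hf, hf, ev1_d2l_apply_zero, d2l_apply_zero, neg_neg] at h
    simpa [Tcw_apply] using hD _ _ h k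
  have hshift (x y z k : ℤ) : f x (y + z) k = f x z (k - y) := by
    have h := hφ.leibniz_zero (by simp [BCW]) (by simp [BCW]) (Lcw x) (Lcw y) (Lcw z)
    rw [BCW_Lcw_Lcw_apply_zero, hφ.bilin.d_right, hf, hf, hf, d2l_apply_zero, d2l_apply_zero,
      BCW_DCW_left_apply_zero, zero_add, Finsupp.add_apply, shift1, mapDomain_succ_zero,
      add_zero, D1, Finsupp.mapRange_apply, d2l_apply_zero] at h
    have h' := DFunLike.congr_fun h k
    rw [BCW_Lcw_left_apply_zero, DCW_apply, DCW_apply, DCW_apply] at h'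
    simpa [Tcw_apply] using h'
  have hzero (i j k : ℤ) : f i j k = f 0 0 (k - i - j) := by
    have h₁ := hshift i j 0 k
    have h₂ := hshift 0 i 0 (k - j)
    rw [add_zero] at h₁ h₂
    rw [h₁, hsymm, h₂, sub_right_comm]
  intro i j k m n
  rw [hzero i j, hzero m n]
  congr 1
  ring

end ConfBider
end
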